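/- arXiv:1505.07488 — 2 statements merged into one kernel-verified Lean document; each statement's English description precedes it below -/
import Mathlib

section
/- Fix ℓ > 0 and a unit vector e ∈ ℝᴺ, and define Ψ₁(ℓ) = ∫_{ℝᴺ} (e·∇(w^p))(x) · (e·∇w)(x − ℓ e) dx and, for any unit vector e' orthogonal to e, Ψ₂(ℓ) = ∫_{ℝᴺ} (e'·∇(w^p))(x) · (e'·∇w)(x − ℓ e) dx. Then: (i) the value Ψ₂(ℓ) does not depend on the choice of the unit vector e' orthogonal to e, and neither Ψ₁(ℓ) nor Ψ₂(ℓ) depends on the choice of the unit vector e; and (ii) for all vectors a, b ∈ ℝᴺ, ∫_{ℝᴺ} p w(x)^{p−1} (a·∇w(x)) (b·∇w(x − ℓ e)) dx = (a·e)(b·e) Ψ₁(ℓ) + (a·b − (a·e)(b·e)) Ψ₂(ℓ). -/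
open MeasureTheory RealInnerProductSpace

section Reflections

variable {E : Type*} [NormedAddCommGroup E] [InnerProductSpace ℝ E]

lemma reflection_orthogonal_span_singleton_of_inner_eq_zero {u v : E} (h : ⟪v, u⟫ = 0) :
    (ℝ ∙ u)ᗮ.reflection v = v :=
  Submodule.reflection_mem_subspace_eq_self
    (Submodule.mem_orthogonal_singleton_iff_inner_left.2 h)

/-- Any orthogonal pair can be moved to any other orthogonal pair with the same norms by a linear
isometry. -/
lemma exists_linearIsometryEquiv_map_pair {e f u v : E} (hef : ‖e‖ = ‖f‖) (huv : ‖u‖ = ‖v‖)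
    (heu : ⟪e, u⟫ = 0) (hfv : ⟪f, v⟫ = 0) : ∃ R : E ≃ₗᵢ[ℝ] E, R e = f ∧ R u = v := by
  set S : E ≃ₗᵢ[ℝ] E := (ℝ ∙ (e - f))ᗮ.reflection
  have hSe : S e = f := Submodule.reflection_sub hef
  have hfS : ⟪f, S u⟫ = 0 := by rw [← hSe, S.inner_map_map, heu]
  refine ⟨S.trans (ℝ ∙ (S u - v))ᗮ.reflection, ?_, ?_⟩
  · rw [LinearIsometryEquiv.trans_apply, hSe]
    exact reflection_orthogonal_span_singleton_of_inner_eq_zero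
      (by rw [inner_sub_right, hfS, hfv, sub_zero])
  · rw [LinearIsometryEquiv.trans_apply]
    exact Submodule.reflection_sub (by rw [S.norm_map, huv])

/-- A bilinear form invariant under all linear isometries fixing a unit vector `e` is diagonal
with respect to the decomposition of the space into the line through `e` and its orthogonal
complement. -/
lemma LinearMap.apply_eq_of_invariant_of_fix (B : E →ₗ[ℝ] E →ₗ[ℝ] ℝ) {e e' : E}
    (he : ‖e‖ = 1) (he' : ‖e'‖ = 1) (hee' : ⟪e, e'⟫ = 0)
    (hB : ∀ R : E ≃ₗᵢ[ℝ] E, R e = e → ∀ a b, B (R a) (R b) = B a b) (a b : E) :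
    B a b = ⟪a, e⟫ * ⟪b, e⟫ * B e e + (⟪a, b⟫ - ⟪a, e⟫ * ⟪b, e⟫) * B e' e' := by
  have hzero : ∀ u v : E, ⟪e, u⟫ = 0 → ⟪v, u⟫ = 0 → B u v = 0 ∧ B v u = 0 := by
    intro u v heu hvu
    have hR := hB (ℝ ∙ u)ᗮ.reflection (reflection_orthogonal_span_singleton_of_inner_eq_zero heu)
    have h1 := hR u v
    have h2 := hR v u
    rw [Submodule.reflection_orthogonalComplement_singleton_eq_neg,
      reflection_orthogonal_span_singleton_of_inner_eq_zero hvu] at h1 h2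
    simp only [map_neg, LinearMap.neg_apply] at h1 h2
    constructor <;> linarith
  have hdiag : ∀ u : E, ⟪e, u⟫ = 0 → B u u = ‖u‖ ^ 2 * B e' e' := by
    intro u heu
    obtain ⟨R, hRe, hRu⟩ := exists_linearIsometryEquiv_map_pair (e := e) (f := e) (u := u)
      (v := ‖u‖ • e') rfl (by rw [norm_smul, he', norm_norm, mul_one]) heu
      (by rw [inner_smul_right, hee', mul_zero])
    rw [← hB R hRe u u, hRu]
    simp only [map_smul, LinearMap.smul_apply, smul_eq_mul]
    ring
  have horth : ∀ u v : E, ⟪e, u⟫ = 0 → ⟪e, v⟫ = 0 → B u v = ⟪u, v⟫ * B e' e' := by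
    intro u v heu hev
    rcases eq_or_ne u 0 with rfl | hu
    · simp
    have hn : ‖u‖ ^ 2 ≠ 0 := pow_ne_zero 2 (norm_ne_zero_iff.2 hu)
    have hperp : ⟪v - (⟪u, v⟫ / ‖u‖ ^ 2) • u, u⟫ = 0 := by
      rw [inner_sub_left, real_inner_smul_left, real_inner_self_eq_norm_sq, div_mul_cancel₀ _ hn,
        real_inner_comm, sub_self]
    have h := (hzero u _ heu hperp).1
    rw [map_sub, map_smul, hdiag u heu, smul_eq_mul, sub_eq_zero, ← mul_assoc,
      div_mul_cancel₀ _ hn] at h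
    exact h
  have hee : ⟪e, e⟫ = 1 := by rw [real_inner_self_eq_norm_sq, he, one_pow]
  have hperp : ∀ a : E, ⟪e, a - ⟪a, e⟫ • e⟫ = 0 := fun a => by
    rw [inner_sub_right, real_inner_smul_right, hee, mul_one, real_inner_comm, sub_self]
  have ha := hzero (a - ⟪a, e⟫ • e) e (hperp a) (hperp a)
  have hb := hzero (b - ⟪b, e⟫ • e) e (hperp b) (hperp b)
  have hab := horth _ _ (hperp a) (hperp b)
  simp only [map_sub, map_smul, LinearMap.sub_apply, LinearMap.smul_apply, smul_eq_mul,
    inner_sub_left, inner_sub_right, real_inner_smul_left, real_inner_smul_right, hee] at ha hb hab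
  rw [real_inner_comm b e] at hab
  linear_combination hab + ⟪b, e⟫ * ha.1 + ⟪a, e⟫ * hb.2

end Reflections

section Radial

variable {E : Type*} [NormedAddCommGroup E] [InnerProductSpace ℝ E]

lemma fderiv_apply_map_of_radial {w : E → ℝ} {g : ℝ → ℝ} (hrad : ∀ x, w x = g ‖x‖)
    (R : E ≃ₗᵢ[ℝ] E) (x v : E) : fderiv ℝ w (R x) (R v) = fderiv ℝ w x v := by
  have h : w ∘ R = w := funext fun y => by simp [hrad]
  have h2 := R.toContinuousLinearEquiv.comp_right_fderiv (f := w) (x := x)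
  have h3 : w ∘ R.toContinuousLinearEquiv = w := h
  rw [h3] at h2
  rw [h2]
  rfl

lemma fderiv_rpow_const_apply {w : E → ℝ} (hwpos : ∀ x, 0 < w x) (hw : ContDiff ℝ 1 w) (p : ℝ)
    (x v : E) : fderiv ℝ (fun y => w y ^ p) x v = p * w x ^ (p - 1) * fderiv ℝ w x v := by
  rw [((hw.differentiable one_ne_zero x).hasFDerivAt.rpow_const (Or.inl (hwpos x).ne')).fderiv]
  rfl

variable [FiniteDimensional ℝ E] [MeasurableSpace E] [BorelSpace E]

lemma integrable_exp_neg_norm : Integrable fun x : E => Real.exp (-‖x‖) := by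
  set n := Module.finrank ℝ E + 1 with hn
  have hint : Integrable fun x : E => (1 + ‖x‖) ^ (-(n : ℝ)) :=
    integrable_one_add_norm (by rw [hn]; push_cast; linarith)
  refine (hint.const_mul (n.factorial * Real.exp 1)).mono'
    (by fun_prop : Continuous fun x : E => Real.exp (-‖x‖)).aestronglyMeasurable
    (Filter.Eventually.of_forall fun x => ?_)
  have hx : 0 < 1 + ‖x‖ := by positivity
  have h := Real.pow_div_factorial_le_exp (1 + ‖x‖) hx.le n
  rw [div_le_iff₀ (by positivity), Real.exp_add] at h
  rw [Real.norm_eq_abs, Real.abs_exp, Real.exp_neg, Real.rpow_neg hx.le, Real.rpow_natCast,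
    ← div_eq_mul_inv, le_div_iff₀ (by positivity), inv_mul_le_iff₀ (Real.exp_pos _)]
  linarith

variable {w : E → ℝ} {p C₀ : ℝ}

lemma integrable_rpow_mul_fderiv_mul_fderiv_sub (hwpos : ∀ x, 0 < w x) (hw : ContDiff ℝ 1 w)
    (hp : 1 < p) (hdecay : ∀ x, w x + ‖fderiv ℝ w x‖ ≤ C₀ * Real.exp (-‖x‖)) (y a b : E) :
    Integrable fun x => p * w x ^ (p - 1) * fderiv ℝ w x a * fderiv ℝ w (x - y) b := by
  have hC : 0 < C₀ := by
    have := hdecay 0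
    simp only [norm_zero, neg_zero, Real.exp_zero, mul_one] at this
    linarith [hwpos 0, norm_nonneg (fderiv ℝ w 0)]
  have hexp : ∀ x : E, C₀ * Real.exp (-‖x‖) ≤ C₀ := fun x =>
    mul_le_of_le_one_right hC.le (Real.exp_le_one_iff.2 (neg_nonpos.2 (norm_nonneg x)))
  have hwC : ∀ x, w x ≤ C₀ := fun x =>
    (le_add_of_nonneg_right (norm_nonneg _)).trans ((hdecay x).trans (hexp x))
  have hdexp : ∀ x, ‖fderiv ℝ w x‖ ≤ C₀ * Real.exp (-‖x‖) := fun x =>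
    (le_add_of_nonneg_left (hwpos x).le).trans (hdecay x)
  have hcont : Continuous (fderiv ℝ w) := hw.continuous_fderiv one_ne_zero
  have hwp : Continuous fun x => w x ^ (p - 1) :=
    hw.continuous.rpow_const fun x => Or.inl (hwpos x).ne'
  refine (integrable_exp_neg_norm.const_mul
    (p * C₀ ^ (p - 1) * (C₀ * ‖a‖) * (C₀ * ‖b‖))).mono'
    (by fun_prop : Continuous _).aestronglyMeasurable (Filter.Eventually.of_forall fun x => ?_)
  have hpow : ‖w x ^ (p - 1)‖ ≤ C₀ ^ (p - 1) := by
    rw [Real.norm_of_nonneg (Real.rpow_nonneg (hwpos x).le _)]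
    exact Real.rpow_le_rpow (hwpos x).le (hwC x) (by linarith)
  calc ‖p * w x ^ (p - 1) * fderiv ℝ w x a * fderiv ℝ w (x - y) b‖
      = p * ‖w x ^ (p - 1)‖ * ‖fderiv ℝ w x a‖ * ‖fderiv ℝ w (x - y) b‖ := by
        rw [norm_mul, norm_mul, norm_mul, Real.norm_of_nonneg (by linarith : 0 ≤ p)]
    _ ≤ p * C₀ ^ (p - 1) * (C₀ * Real.exp (-‖x‖) * ‖a‖) * (C₀ * ‖b‖) := by
        have := (fderiv ℝ w x).le_of_opNorm_le (hdexp x) a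
        have := (fderiv ℝ w (x - y)).le_of_opNorm_le ((hdexp _).trans (hexp _)) b
        gcongr
    _ = p * C₀ ^ (p - 1) * (C₀ * ‖a‖) * (C₀ * ‖b‖) * Real.exp (-‖x‖) := by ring

lemma integral_rpow_mul_fderiv_mul_fderiv_sub_map {g : ℝ → ℝ} (hrad : ∀ x, w x = g ‖x‖)
    (R : E ≃ₗᵢ[ℝ] E) (y a b : E) :
    ∫ x, p * w x ^ (p - 1) * fderiv ℝ w x (R a) * fderiv ℝ w (x - R y) (R b) =
      ∫ x, p * w x ^ (p - 1) * fderiv ℝ w x a * fderiv ℝ w (x - y) b := by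
  rw [← R.measurePreserving.integral_comp R.toHomeomorph.measurableEmbedding]
  refine integral_congr_ae (Filter.Eventually.of_forall fun x => ?_)
  have hR : w (R x) = w x := by rw [hrad, hrad, R.norm_map]
  simp only [← map_sub, fderiv_apply_map_of_radial hrad, hR]

/-- The bilinear form `(a, b) ↦ ∫ (a·∇(w^p))(x) (b·∇w)(x − y) dx`. -/
lemma exists_bilinear_eq_integral (hwpos : ∀ x, 0 < w x) (hw : ContDiff ℝ 1 w)
    (hp : 1 < p) (hdecay : ∀ x, w x + ‖fderiv ℝ w x‖ ≤ C₀ * Real.exp (-‖x‖)) (y : E) :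
    ∃ B : E →ₗ[ℝ] E →ₗ[ℝ] ℝ, ∀ a b,
      B a b = ∫ x, p * w x ^ (p - 1) * fderiv ℝ w x a * fderiv ℝ w (x - y) b := by
  have hint := integrable_rpow_mul_fderiv_mul_fderiv_sub hwpos hw hp hdecay y
  refine ⟨LinearMap.mk₂ ℝ
    (fun a b => ∫ x, p * w x ^ (p - 1) * fderiv ℝ w x a * fderiv ℝ w (x - y) b)
    (fun a₁ a₂ b => ?_) (fun c a b => ?_) (fun a b₁ b₂ => ?_) (fun c a b => ?_),
    fun a b => rfl⟩
  · simp only [map_add, mul_add, add_mul]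
    exact integral_add (hint a₁ b) (hint a₂ b)
  · simp only [map_smul, smul_eq_mul]
    rw [← integral_const_mul]
    congr 1 with x
    ring
  · simp only [map_add, mul_add]
    exact integral_add (hint a b₁) (hint a b₂)
  · simp only [map_smul, smul_eq_mul]
    rw [← integral_const_mul]
    congr 1 with x
    ring

end Radial

/-- For `Ψ e f = ∫ (f·∇(w^p))(x) (f·∇w)(x − ℓe) dx`: (i) `Ψ e e'` does not
depend on the unit vector `e'` orthogonal to `e`, and neither `Ψ₁ = Ψ e e` nor `Ψ₂ = Ψ e e'`
depends on the unit vector `e`; (ii) for all `a, b ∈ ℝᴺ`,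
`∫ p w^{p−1} (a·∇w)(x) (b·∇w)(x − ℓe) dx = (a·e)(b·e) Ψ₁(ℓ) + (a·b − (a·e)(b·e)) Ψ₂(ℓ)`. -/
theorem stmt_10 (N : ℕ) (hN : 2 ≤ N) (p : ℝ) (hp : 1 < p)
    (w : EuclideanSpace ℝ (Fin N) → ℝ)
    (hwpos : ∀ x, 0 < w x) (hw : ContDiff ℝ 1 w)
    (g : ℝ → ℝ) (hrad : ∀ x, w x = g ‖x‖)
    (C₀ : ℝ) (hdecay : ∀ x, w x + ‖fderiv ℝ w x‖ ≤ C₀ * Real.exp (-‖x‖))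
    (ℓ : ℝ) (hℓ : 0 < ℓ)
    (Ψ : EuclideanSpace ℝ (Fin N) → EuclideanSpace ℝ (Fin N) → ℝ)
    (hΨ : ∀ e f, Ψ e f =
      ∫ x, fderiv ℝ (fun y => w y ^ p) x f * fderiv ℝ w (x - ℓ • e) f) :
    ((∀ e e₁ e₂ : EuclideanSpace ℝ (Fin N), ‖e‖ = 1 → ‖e₁‖ = 1 → ‖e₂‖ = 1 →
        ⟪e, e₁⟫ = 0 → ⟪e, e₂⟫ = 0 → Ψ e e₁ = Ψ e e₂) ∧
      (∀ e f : EuclideanSpace ℝ (Fin N), ‖e‖ = 1 → ‖f‖ = 1 → Ψ e e = Ψ f f) ∧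
      (∀ e e₁ f f₁ : EuclideanSpace ℝ (Fin N), ‖e‖ = 1 → ‖e₁‖ = 1 → ‖f‖ = 1 → ‖f₁‖ = 1 →
        ⟪e, e₁⟫ = 0 → ⟪f, f₁⟫ = 0 → Ψ e e₁ = Ψ f f₁)) ∧
    (∀ e e' : EuclideanSpace ℝ (Fin N), ‖e‖ = 1 → ‖e'‖ = 1 → ⟪e, e'⟫ = 0 →
      ∀ a b : EuclideanSpace ℝ (Fin N),
        ∫ x, p * w x ^ (p - 1) * fderiv ℝ w x a * fderiv ℝ w (x - ℓ • e) b
          = ⟪a, e⟫ * ⟪b, e⟫ * Ψ e e + (⟪a, b⟫ - ⟪a, e⟫ * ⟪b, e⟫) * Ψ e e') := by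
  have hΨ' : ∀ e f, Ψ e f =
      ∫ x, p * w x ^ (p - 1) * fderiv ℝ w x f * fderiv ℝ w (x - ℓ • e) f := fun e f => by
    simp only [hΨ, fderiv_rpow_const_apply hwpos hw]
  have hmap : ∀ (R : EuclideanSpace ℝ (Fin N) ≃ₗᵢ[ℝ] EuclideanSpace ℝ (Fin N)) e f,
      Ψ (R e) (R f) = Ψ e f := fun R e f => by
    rw [hΨ', hΨ', ← map_smul, integral_rpow_mul_fderiv_mul_fderiv_sub_map hrad]
  have hpair : ∀ e e₁ f f₁ : EuclideanSpace ℝ (Fin N), ‖e‖ = 1 → ‖e₁‖ = 1 → ‖f‖ = 1 →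
      ‖f₁‖ = 1 → ⟪e, e₁⟫ = 0 → ⟪f, f₁⟫ = 0 → Ψ e e₁ = Ψ f f₁ := by
    intro e e₁ f f₁ he he₁ hf hf₁ hee₁ hff₁
    obtain ⟨R, rfl, rfl⟩ := exists_linearIsometryEquiv_map_pair (he.trans hf.symm)
      (he₁.trans hf₁.symm) hee₁ hff₁
    exact (hmap R e e₁).symm
  refine ⟨⟨fun e e₁ e₂ he he₁ he₂ h₁ h₂ => hpair e e₁ e e₂ he he₁ he he₂ h₁ h₂,
    fun e f he hf => ?_, hpair⟩, fun e e' he he' hee' a b => ?_⟩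
  · have h := hmap (ℝ ∙ (e - f))ᗮ.reflection e e
    rw [Submodule.reflection_sub (he.trans hf.symm)] at h
    exact h.symm
  · obtain ⟨B, hB⟩ := exists_bilinear_eq_integral hwpos hw hp hdecay (ℓ • e)
    rw [hΨ' e e, hΨ' e e', ← hB, ← hB, ← hB]
    refine B.apply_eq_of_invariant_of_fix he he' hee' (fun R hR a b => ?_) a b
    have h := integral_rpow_mul_fderiv_mul_fderiv_sub_map (p := p) hrad R (ℓ • e) a b
    rw [map_smul, hR] at h
    rw [hB, hB, h]
end

section
/- The finite set Π := { R_k^i y_j : i ∈ {0,…,k−1}, j ∈ {1,…,m+2n} } ⊂ ℝ² is invariant both under the rotation R_k and under the reflection Γ, i.e., R_k(Π) = Π and Γ(Π) = Π, where Γ(x₁, x₂) = (x₁, −x₂). -/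
/-- A map of finite order that maps a set into itself maps it onto itself. -/
theorem Set.MapsTo.image_eq_of_iterate_succ_eq_id {α : Type*} {f : α → α} {s : Set α}
    (hs : Set.MapsTo f s s) {n : ℕ} (hf : f^[n + 1] = id) : f '' s = s := by
  refine hs.image_subset.antisymm fun z hz => ⟨f^[n] z, hs.iterate n hz, ?_⟩
  rw [← Function.iterate_succ_apply' f n z, hf, id]

/-- The iterates of the rotation by the angle `θ` are the rotations by its multiples. -/
theorem iterate_rotation_apply {θ : ℝ} {R : ℝ × ℝ → ℝ × ℝ}
    (hR : ∀ x, R x = (Real.cos θ * x.1 - Real.sin θ * x.2, Real.sin θ * x.1 + Real.cos θ * x.2))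
    (i : ℕ) (x : ℝ × ℝ) :
    R^[i] x = (Real.cos (i * θ) * x.1 - Real.sin (i * θ) * x.2,
      Real.sin (i * θ) * x.1 + Real.cos (i * θ) * x.2) := by
  induction i with
  | zero => simp
  | succ i ih =>
    rw [Function.iterate_succ_apply', ih, hR]
    push_cast
    rw [add_mul, one_mul, Real.cos_add, Real.sin_add]
    ext <;> dsimp only <;> ring

/-- Conjugating a rotation by the reflection in the first axis inverts it. -/
theorem rotation_reflection_rotation {θ : ℝ} {R Γ : ℝ × ℝ → ℝ × ℝ}
    (hR : ∀ x, R x = (Real.cos θ * x.1 - Real.sin θ * x.2, Real.sin θ * x.1 + Real.cos θ * x.2))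
    (hΓ : ∀ x, Γ x = (x.1, -x.2)) (x : ℝ × ℝ) : R (Γ (R x)) = Γ x := by
  simp only [hR, hΓ]
  ext <;> dsimp only
  · linear_combination x.1 * Real.sin_sq_add_cos_sq θ
  · linear_combination -x.2 * Real.sin_sq_add_cos_sq θ

/-- If `Γ` conjugates `R` to its inverse and sends each generating point into the `R`-orbit of a
generating point, then the union of the orbits is invariant under `R` and `Γ`. -/
theorem image_orbits_eq {α : Type*} {k : ℕ} (hk : 0 < k) {R Γ : α → α} (hRk : R^[k] = id)
    (hΓ : Function.Involutive Γ) (hRΓ : ∀ x, R (Γ (R x)) = Γ x) {Y : Set α}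
    (hY : ∀ x ∈ Y, ∃ i, ∃ x' ∈ Y, Γ x = R^[i] x') :
    R '' {z | ∃ i < k, ∃ x ∈ Y, z = R^[i] x} = {z | ∃ i < k, ∃ x ∈ Y, z = R^[i] x} ∧
      Γ '' {z | ∃ i < k, ∃ x ∈ Y, z = R^[i] x} = {z | ∃ i < k, ∃ x ∈ Y, z = R^[i] x} := by
  obtain ⟨l, rfl⟩ : ∃ l, k = l + 1 := ⟨k - 1, by omega⟩
  have mem_orbits : ∀ i, ∀ x ∈ Y, R^[i] x ∈ {z | ∃ i < l + 1, ∃ x ∈ Y, z = R^[i] x} := by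
    intro i x hx
    have hper : Function.IsPeriodicPt R (l + 1) x := congrFun hRk x
    exact ⟨i % (l + 1), Nat.mod_lt _ hk, x, hx, (hper.iterate_mod_apply i).symm⟩
  have hsemi : Function.Semiconj Γ R R^[l] := by
    intro x
    rw [← hRΓ x, ← Function.iterate_succ_apply, hRk, id]
  constructor
  · refine Set.MapsTo.image_eq_of_iterate_succ_eq_id ?_ hRk
    rintro _ ⟨i, -, x, hx, rfl⟩
    rw [← Function.iterate_succ_apply' R i x]
    exact mem_orbits _ x hx
  · refine Set.MapsTo.image_eq_of_iterate_succ_eq_id (n := 1) ?_ (funext hΓ)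
    rintro _ ⟨i, -, x, hx, rfl⟩
    obtain ⟨i', x', hx', h⟩ := hY x hx
    rw [(hsemi.iterate_right i).eq, h, ← Function.iterate_mul, ← Function.iterate_add_apply]
    exact mem_orbits _ x' hx'


/-- The finite set `Π = {R_k^i y_j : 0 ≤ i < k, 1 ≤ j ≤ m+2n} ⊂ ℝ²` is
invariant under the rotation `R_k` by the angle `2π/k` and under the reflection
`Γ(x₁,x₂) = (x₁,−x₂)`. -/
theorem stmt_12 (k m n : ℕ) (hk : 7 ≤ k) (hm : 1 ≤ m) (hn : 1 ≤ n)
    (ℓ ℓb : ℝ) (hℓ : 0 < ℓ) (hℓb : 0 < ℓb)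
    (hbal : 2 * Real.sin (Real.pi / k) * m * ℓ = (2 * n - 1) * ℓb)
    (R : ℝ × ℝ → ℝ × ℝ)
    (hR : ∀ x : ℝ × ℝ, R x =
      (Real.cos (2 * Real.pi / k) * x.1 - Real.sin (2 * Real.pi / k) * x.2,
       Real.sin (2 * Real.pi / k) * x.1 + Real.cos (2 * Real.pi / k) * x.2))
    (t : ℝ × ℝ) (ht : t = (-Real.sin (Real.pi / k), Real.cos (Real.pi / k)))
    (y : ℕ → ℝ × ℝ)
    (hy1 : y 1 = (ℓb / (2 * Real.sin (Real.pi / k)), 0))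
    (hy2 : ∀ j : ℕ, 2 ≤ j → j ≤ m + 1 →
      y j = y 1 + (((j : ℝ) - 1) * ℓ) • ((1 : ℝ), (0 : ℝ)))
    (hy3 : ∀ j : ℕ, m + 2 ≤ j → j ≤ m + 2 * n →
      y j = y (m + 1) + (((j : ℝ) - (m : ℝ) - 1) * ℓb) • t)
    (Pts : Set (ℝ × ℝ))
    (hPts : Pts = {z | ∃ i < k, ∃ j : ℕ, 1 ≤ j ∧ j ≤ m + 2 * n ∧ z = R^[i] (y j)})
    (Γ : ℝ × ℝ → ℝ × ℝ) (hΓ : ∀ x : ℝ × ℝ, Γ x = (x.1, -x.2)) :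
    R '' Pts = Pts ∧ Γ '' Pts = Pts := by
  have hk0 : (k : ℝ) ≠ 0 := by positivity
  have hs : Real.sin (Real.pi / k) ≠ 0 := by
    refine (Real.sin_pos_of_pos_of_lt_pi (by positivity) ?_).ne'
    exact div_lt_self Real.pi_pos (by exact_mod_cast (by omega : 1 < k))
  have hRk : R^[k] = id := by
    funext x
    rw [iterate_rotation_apply hR, mul_div_cancel₀ _ hk0]
    simp
  have hΓ2 : Function.Involutive Γ := fun x => by simp [hΓ]
  have hRΓ := rotation_reflection_rotation hR hΓ
  have hy2' : ∀ j : ℕ, 1 ≤ j → j ≤ m + 1 →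
      y j = (ℓb / (2 * Real.sin (Real.pi / k)) + ((j : ℝ) - 1) * ℓ, 0) := by
    intro j h1 hj
    rcases h1.eq_or_lt with rfl | h1
    · simp [hy1]
    · rw [hy2 j h1 hj, hy1]
      simp
  have hcorner : y (m + 1) = (n * ℓb / Real.sin (Real.pi / k), 0) := by
    rw [hy2' (m + 1) (by omega) le_rfl]
    ext
    · push_cast
      field_simp
      linear_combination hbal
    · rfl
  have hside : ∀ j : ℕ, m + 2 ≤ j → j ≤ m + 2 * n →
      R (Γ (y j)) = y (2 * m + 2 * n + 2 - j) := by
    intro j h1 h2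
    have hj : ((2 * m + 2 * n + 2 - j : ℕ) : ℝ) = 2 * m + 2 * n + 2 - j := by
      rw [Nat.cast_sub (by omega)]
      push_cast
      ring
    have h2θ : 2 * Real.pi / k = 2 * (Real.pi / k) := by ring
    have hsq := Real.sin_sq_add_cos_sq (Real.pi / k)
    rw [hy3 j h1 h2, hy3 (2 * m + 2 * n + 2 - j) (by omega) (by omega), hj, hR, hΓ, hcorner, ht, h2θ, Real.sin_two_mul,
      Real.cos_two_mul']
    generalize Real.sin (Real.pi / k) = s at *
    generalize Real.cos (Real.pi / k) = c at *
    obtain ⟨r, hr⟩ : ∃ r, r = n * ℓb / s := ⟨_, rfl⟩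
    have hrs : r * s = n * ℓb := by rw [hr, div_mul_cancel₀ _ hs]
    rw [← hr]
    ext <;> simp only [Prod.fst_add, Prod.snd_add, Prod.smul_mk, smul_eq_mul]
    · linear_combination (r + (j - m - 1) * ℓb * s) * hsq - 2 * s * hrs
    · linear_combination 2 * c * hrs - (j - m - 1) * ℓb * c * hsq
  have key := image_orbits_eq (Y := {x | ∃ j, (1 ≤ j ∧ j ≤ m + 2 * n) ∧ x = y j})
    (by omega : 0 < k) hRk hΓ2 hRΓ ?_
  · have hP : Pts = {z | ∃ i < k, ∃ x ∈ {x | ∃ j, (1 ≤ j ∧ j ≤ m + 2 * n) ∧ x = y j},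
        z = R^[i] x} := by
      rw [hPts]
      ext z
      constructor
      · rintro ⟨i, hi, j, h1, h2, rfl⟩
        exact ⟨i, hi, y j, ⟨j, ⟨h1, h2⟩, rfl⟩, rfl⟩
      · rintro ⟨i, hi, _, ⟨j, ⟨h1, h2⟩, rfl⟩, rfl⟩
        exact ⟨i, hi, j, h1, h2, rfl⟩
    rwa [hP]
  · rintro _ ⟨j, ⟨h1, h2⟩, rfl⟩
    rcases Nat.lt_or_ge (m + 1) j with hj | hj
    · refine ⟨k - 1, _, ⟨2 * m + 2 * n + 2 - j, by omega, rfl⟩, ?_⟩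
      rw [← hside j hj h2, ← Function.iterate_succ_apply, Nat.succ_eq_add_one,
        Nat.sub_add_cancel (by omega), hRk, id]
    · refine ⟨0, _, ⟨j, ⟨h1, h2⟩, rfl⟩, ?_⟩
      simp [hΓ, hy2' j h1 hj]
end
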